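/- Fix a point of U. Let N̲, H̲ ∈ ℝ^4 be linearly independent, let Θ, U', Ω̸ ∈ ℝ^4 each be g-orthogonal to both N̲ and H̲ (g(Θ,N̲) = g(Θ,H̲) = g(U',N̲) = g(U',H̲) = g(Ω̸,N̲) = g(Ω̸,H̲) = 0), let h̲ ≠ 0 and κ be real numbers, and let S ∈ ℝ^4 be Σ_t-tangent (S^0 = 0) with S + (Σ_a S^a N̲_a) B = κ H̲ + U', where N̲_a := g_{aμ} N̲^μ. Define E̲ := h̲^{-1} H̲ + Θ and Y := κ Θ - h̲^{-1} U'. Then ε_{αβγδ} E̲^α Ω̸^β N̲^γ ( S^δ + (Σ_a S^a N̲_a) B^δ ) = ε_{αβγδ} N̲^α H̲^β Y^γ Ω̸^δ, where ε_{αβγδ} is the totally antisymmetric symbol with ε_{0123} = 1. -/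

import Mathlib

noncomputable section

open scoped BigOperators

/-- The set of spatial indices `{1,2,3} ⊆ Fin 4`. -/
def spIdx : Finset (Fin 4) := {1, 2, 3}

/-- The components `g_{αβ}` of the acoustical metric determined by the sound
speed `c` and the velocity components `v` at a point (recall `v 0 = 0`):
`g_{00} = -1 + c⁻² Σₐ (vᵃ)²`, `g_{0i} = g_{i0} = -c⁻² vⁱ`, `g_{ij} = c⁻² δ_{ij}`. -/
def gmet (c : ℝ) (v : Fin 4 → ℝ) (α β : Fin 4) : ℝ :=
  if α = 0 then
    if β = 0 then -1 + (∑ a ∈ spIdx, v a ^ 2) / c ^ 2 else -v β / c ^ 2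
  else
    if β = 0 then -v α / c ^ 2 else (if α = β then (1 : ℝ) else 0) / c ^ 2

/-- The components of the inverse acoustical metric:
`G^{00} = -1`, `G^{0i} = G^{i0} = -vⁱ`, `G^{ij} = c² δ^{ij} - vⁱ vʲ`. -/
def ginv (c : ℝ) (v : Fin 4 → ℝ) (α β : Fin 4) : ℝ :=
  if α = 0 then
    if β = 0 then -1 else -v β
  else
    if β = 0 then -v α else c ^ 2 * (if α = β then (1 : ℝ) else 0) - v α * v β

/-- The material vectorfield `B = (1, v¹, v², v³)` (recall `v 0 = 0`). -/
def Bvec (v : Fin 4 → ℝ) (α : Fin 4) : ℝ := (if α = 0 then (1 : ℝ) else 0) + v α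

/-- The inner product `g(X,Y) = g_{αβ} X^α Y^β`. -/
def gip (c : ℝ) (v : Fin 4 → ℝ) (X Y : Fin 4 → ℝ) : ℝ :=
  ∑ α : Fin 4, ∑ β : Fin 4, gmet c v α β * X α * Y β

/-- Index lowering with `g`:  `X_α = g_{αβ} X^β`. -/
def glow (c : ℝ) (v : Fin 4 → ℝ) (X : Fin 4 → ℝ) (α : Fin 4) : ℝ :=
  ∑ β : Fin 4, gmet c v α β * X β

/-- The partial derivative `∂_α f` at `x`. -/
def pd (f : (Fin 4 → ℝ) → ℝ) (α : Fin 4) (x : Fin 4 → ℝ) : ℝ :=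
  fderiv ℝ f x (Pi.single α 1)

/-- The totally antisymmetric symbol `ε_{αβγδ}`, normalized by `ε_{0123} = 1`. -/
def eps4 (α β γ δ : Fin 4) : ℝ :=
  (((β : ℕ) : ℝ) - ((α : ℕ) : ℝ)) * (((γ : ℕ) : ℝ) - ((α : ℕ) : ℝ)) *
    (((δ : ℕ) : ℝ) - ((α : ℕ) : ℝ)) * (((γ : ℕ) : ℝ) - ((β : ℕ) : ℝ)) *
    (((δ : ℕ) : ℝ) - ((β : ℕ) : ℝ)) * (((δ : ℕ) : ℝ) - ((γ : ℕ) : ℝ)) / 12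

/-- The spatial totally antisymmetric symbol `ε_{ijk}` (vanishing unless all
indices lie in `{1,2,3}`), normalized by `ε_{123} = 1`. -/
def eps3 (i j k : Fin 4) : ℝ := eps4 0 i j k

/-- Contracting `ε` with four vectors gives the determinant of the matrix with these rows. -/
theorem sum_eps4_eq_det (A B C D : Fin 4 → ℝ) :
    (∑ α : Fin 4, ∑ β : Fin 4, ∑ γ : Fin 4, ∑ δ : Fin 4,
        eps4 α β γ δ * A α * B β * C γ * D δ) = (Matrix.of ![A, B, C, D]).det := by
  simp [Matrix.det_succ_row_zero, Fin.sum_univ_succ, Fin.succAbove, eps4]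
  ring

theorem gip_eq_sum_glow (c : ℝ) (v X Y : Fin 4 → ℝ) :
    gip c v X Y = ∑ α : Fin 4, X α * glow c v Y α := by
  simp only [gip, glow, Finset.mul_sum]
  exact Finset.sum_congr rfl fun _ _ => Finset.sum_congr rfl fun _ _ => by ring

theorem sum_ginv_mul_glow {c : ℝ} {v : Fin 4 → ℝ} (hc : c ≠ 0)
    (X : Fin 4 → ℝ) (α : Fin 4) :
    ∑ β : Fin 4, ginv c v α β * glow c v X β = X α := by
  fin_cases α <;>
    simp [Fin.sum_univ_four, ginv, glow, gmet, spIdx] <;> field_simp <;> ring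

theorem glow_sub_smul (c : ℝ) (v X Y : Fin 4 → ℝ) (a b : ℝ) :
    glow c v (a • X - b • Y) = a • glow c v X - b • glow c v Y := by
  ext α
  simp only [glow, Pi.sub_apply, Pi.smul_apply, smul_eq_mul, Finset.mul_sum,
    ← Finset.sum_sub_distrib]
  exact Finset.sum_congr rfl fun _ _ => by ring

theorem eq_zero_of_glow_eq_zero {c : ℝ} {v : Fin 4 → ℝ} (hc : c ≠ 0)
    {X : Fin 4 → ℝ} (h : glow c v X = 0) : X = 0 := by
  ext α
  rw [← sum_ginv_mul_glow (v := v) hc X α]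
  simp [h]

/-- Three vectors `g`-orthogonal to a two-dimensional plane are linearly dependent, so together
with any vector of the plane they span a parallelepiped of zero volume. -/
theorem det_eq_zero_of_gip_eq_zero {c : ℝ} {v : Fin 4 → ℝ} (hc : c ≠ 0)
    {N H X Y Z : Fin 4 → ℝ} (hind : LinearIndependent ℝ ![N, H])
    (hXN : gip c v X N = 0) (hXH : gip c v X H = 0)
    (hYN : gip c v Y N = 0) (hYH : gip c v Y H = 0)
    (hZN : gip c v Z N = 0) (hZH : gip c v Z H = 0) :
    (Matrix.of ![X, Y, N, Z]).det = 0 := by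
  by_contra hdet
  have hker (W : Fin 4 → ℝ) (hX : gip c v X W = 0) (hY : gip c v Y W = 0)
      (hN : gip c v N W = 0) (hZ : gip c v Z W = 0) : W = 0 := by
    refine eq_zero_of_glow_eq_zero (v := v) hc (Matrix.eq_zero_of_mulVec_eq_zero hdet ?_)
    rw [gip_eq_sum_glow] at hX hY hN hZ
    ext i
    fin_cases i
    exacts [hX, hY, hN, hZ]
  have hlin (V : Fin 4 → ℝ) (a b : ℝ) :
      gip c v V (a • N - b • H) = a * gip c v V N - b * gip c v V H := by
    simp only [gip_eq_sum_glow, glow_sub_smul, Pi.sub_apply, Pi.smul_apply, smul_eq_mul,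
      Finset.mul_sum, ← Finset.sum_sub_distrib]
    exact Finset.sum_congr rfl fun _ _ => by ring
  have hcomb : gip c v N H • N - gip c v N N • H = 0 := by
    apply hker <;> simp only [hlin, hXN, hXH, hYN, hYH, hZN, hZH] <;> ring
  have hNN : gip c v N N = 0 := by
    have := LinearIndependent.pair_iff.1 hind (gip c v N H) (-gip c v N N)
      (by rw [neg_smul, ← sub_eq_add_neg, hcomb])
    exact neg_eq_zero.1 this.2
  exact hind.ne_zero 0 (hker N hXN hYN hNN hZN)

/-- With `E̲ := h̲⁻¹H̲ + Θ` and `Y := κΘ - h̲⁻¹U'`,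
`ε_{αβγδ} E̲^α Ω̸^β N̲^γ (S^δ + (ΣₐSᵃN̲ₐ)B^δ) = ε_{αβγδ} N̲^α H̲^β Y^γ Ω̸^δ`. -/
theorem stmt16_rearranging_the_determinant_product
    (c : ℝ) (v : Fin 4 → ℝ) (hc : 0 < c) (hv0 : v 0 = 0)
    (Nb Hb Θv U' Om S : Fin 4 → ℝ)
    (hind : LinearIndependent ℝ ![Nb, Hb])
    (hΘNb : gip c v Θv Nb = 0) (hΘHb : gip c v Θv Hb = 0)
    (hUNb : gip c v U' Nb = 0) (hUHb : gip c v U' Hb = 0)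
    (hOmNb : gip c v Om Nb = 0) (hOmHb : gip c v Om Hb = 0)
    (hb κ : ℝ) (hbne : hb ≠ 0)
    (hS0 : S 0 = 0)
    (hSdec : ∀ μ : Fin 4,
      S μ + (∑ a ∈ spIdx, S a * glow c v Nb a) * Bvec v μ = κ * Hb μ + U' μ)
    (Eb Y : Fin 4 → ℝ)
    (hEb : ∀ α : Fin 4, Eb α = Hb α / hb + Θv α)
    (hY : ∀ α : Fin 4, Y α = κ * Θv α - U' α / hb) :
    (∑ α : Fin 4, ∑ β : Fin 4, ∑ γ : Fin 4, ∑ δ : Fin 4,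
        eps4 α β γ δ * Eb α * Om β * Nb γ *
          (S δ + (∑ a ∈ spIdx, S a * glow c v Nb a) * Bvec v δ))
      = ∑ α : Fin 4, ∑ β : Fin 4, ∑ γ : Fin 4, ∑ δ : Fin 4,
          eps4 α β γ δ * Nb α * Hb β * Y γ * Om δ := by
  have hvol := det_eq_zero_of_gip_eq_zero hc.ne' hind hΘNb hΘHb hOmNb hOmHb hUNb hUHb
  simp only [hSdec]
  rw [sum_eps4_eq_det Nb Hb Y Om, sum_eps4_eq_det Eb Om Nb fun δ => κ * Hb δ + U' δ]
  simp [Matrix.det_succ_row_zero, Fin.sum_univ_succ, Fin.succAbove, hEb, hY] at hvol ⊢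
  linear_combination hvol
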